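/- arXiv:2202.06298 — 14 statements merged into one kernel-verified Lean document; each statement's English description precedes it below -/
import Mathlib

section
/- For every idempotent e of a semigroup X, the set √∞H_e is contained in the 𝟐-class ⇕e of e. -/
universe u

/-- The binary quasiorder `x ≲ y` on a semigroup `X`: `χ x ≤ χ y` for every semigroup
homomorphism `χ : X → 𝟐`, where the two-element semilattice `𝟐 = {0,1}` (with multiplication
inherited from `ℤ`) is represented by `Bool` (with `* = and`, `false ≤ true`). -/
def binLe {X : Type u} [Semigroup X] (x y : X) : Prop :=
  ∀ χ : X →ₙ* Bool, χ x ≤ χ y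

/-- The `𝟐`-class `⇕a = {x | a ≲ x ≲ a}`. -/
def twoClass {X : Type u} [Semigroup X] (a : X) : Set X :=
  {x | binLe a x ∧ binLe x a}

/-- The upper `𝟐`-class `⇑a = {x | a ≲ x}`. -/
def upClass {X : Type u} [Semigroup X] (a : X) : Set X :=
  {x | binLe a x}

/-- The `ℋ`-class of `e`: `{x ∈ X | xX¹ = eX¹ ∧ X¹x = X¹e}`, where `X¹ = WithOne X` is `X`
with an identity adjoined. For an idempotent `e` this is the maximal subgroup containing `e`. -/
def HClass {X : Type u} [Semigroup X] (e : X) : Set X :=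
  {x | (Set.range fun z : WithOne X => (x : WithOne X) * z) =
         (Set.range fun z : WithOne X => (e : WithOne X) * z) ∧
       (Set.range fun z : WithOne X => z * (x : WithOne X)) =
         (Set.range fun z : WithOne X => z * (e : WithOne X))}

/-- `spow x n = x^(n+1)`: the positive powers of an element of a semigroup. -/
def spow {X : Type u} [Semigroup X] (x : X) : ℕ → X
  | 0 => x
  | n + 1 => spow x n * x

/-- `rootInf A = √∞A = {x | x^n ∈ A for some positive integer n}`. -/
def rootInf {X : Type u} [Semigroup X] (A : Set X) : Set X :=
  {x | ∃ n : ℕ, spow x n ∈ A}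

/-- `I` is an ideal of the semigroup `X`: `IX ∪ XI ⊆ I`. -/
def IsIdealSet {X : Type u} [Semigroup X] (I : Set X) : Prop :=
  ∀ a ∈ I, ∀ x : X, a * x ∈ I ∧ x * a ∈ I

/-- A prime coideal: the complement is an ideal and the set itself is a subsemigroup. -/
def IsPrimeCoideal {X : Type u} [Semigroup X] (C : Set X) : Prop :=
  IsIdealSet Cᶜ ∧ ∀ a b : X, a ∈ C → b ∈ C → a * b ∈ C

/-- A semigroup is `𝟐`-trivial if every homomorphism to the two-element semilattice
`𝟐` is constant. -/
def TwoTrivial (X : Type u) [Semigroup X] : Prop :=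
  ∀ χ : X →ₙ* Bool, ∀ a b : X, χ a = χ b

/-- `X` is `E`-separated: distinct idempotents are separated by a homomorphism to a
semilattice (a commutative semigroup of idempotents). -/
def ESeparated (X : Type u) [Semigroup X] : Prop :=
  ∀ x y : X, x * x = x → y * y = y → x ≠ y →
    ∃ (Y : Type u) (mul : Y → Y → Y) (h : X → Y),
      (∀ a b c : Y, mul (mul a b) c = mul a (mul b c)) ∧
      (∀ a b : Y, mul a b = mul b a) ∧
      (∀ a : Y, mul a a = a) ∧
      (∀ a b : X, h (a * b) = mul (h a) (h b)) ∧
      h x ≠ h y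

/-- `X` is duo: `xX = Xx` for every `x ∈ X`. -/
def IsDuo (X : Type u) [Semigroup X] : Prop :=
  ∀ x : X, (Set.range fun a : X => x * a) = (Set.range fun a : X => a * x)

/-- `X` is viable: whenever `xy` and `yx` are both idempotents, `xy = yx`. -/
def Viable (X : Type u) [Semigroup X] : Prop :=
  ∀ x y : X, (x * y) * (x * y) = x * y → (y * x) * (y * x) = y * x → x * y = y * x

/-- `H_e/e = {x ∈ X | xe = ex ∈ H_e}`. -/
def HeOverE {X : Type u} [Semigroup X] (e : X) : Set X :=
  {x | x * e = e * x ∧ e * x ∈ HClass e}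

/-- `X` is `E`-viable: `H_e/e` is a coideal for every idempotent `e`. -/
def EViable (X : Type u) [Semigroup X] : Prop :=
  ∀ e : X, e * e = e → IsIdealSet (HeOverE e)ᶜ

/-- `X` is `E⇑`-central: `ex = xe` for every idempotent `e` and every `x ∈ ⇑e`. -/
def EUpArrowCentral (X : Type u) [Semigroup X] : Prop :=
  ∀ e : X, e * e = e → ∀ x ∈ upClass e, e * x = x * e

/-- `X` is `E`-hypercentral. -/
def EHypercentral (X : Type u) [Semigroup X] : Prop :=
  ∀ e x y : X, e * e = e → x * y = e → x * e = e * x ∧ y * e = e * y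

/-- `X` is `E`-hypocentral. -/
def EHypocentral (X : Type u) [Semigroup X] : Prop :=
  ∀ e x y : X, e * e = e → x * y = e → x * e = e * x ∨ y * e = e * y

/-- `X` is `E`-upcentral. -/
def EUpcentral (X : Type u) [Semigroup X] : Prop :=
  ∀ e f : X, e * e = e → f * f = f → f * e = e → e * f = e →
    ∀ x ∈ rootInf (HClass f), x * e = e * x

/-- `X` is `E`-commutative: idempotents commute. -/
def ECommutative (X : Type u) [Semigroup X] : Prop :=
  ∀ e f : X, e * e = e → f * f = f → e * f = f * e

/-- The Clifford part `H(X) = ⋃_{e ∈ E(X)} H_e`. -/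
def CliffordPart (X : Type u) [Semigroup X] : Set X :=
  {x | ∃ e : X, e * e = e ∧ x ∈ HClass e}

theorem bool_mul_le (a b : Bool) : a * b ≤ a ∧ a * b ≤ b := by
  revert a b; decide

theorem chi_spow {X : Type u} [Semigroup X] (χ : X →ₙ* Bool) (x : X) (n : ℕ) :
    χ (spow x n) = χ x := by
  induction n with
  | zero => rfl
  | succ n ih =>
    have hb : ∀ b : Bool, b * b = b := by decide
    rw [spow, map_mul, ih, hb]

theorem binLe_of_right {X : Type u} [Semigroup X] (χ : X →ₙ* Bool) (a b : X)
    (h : (a : WithOne X) ∈ Set.range fun z : WithOne X => (b : WithOne X) * z) :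
    χ a ≤ χ b := by
  obtain ⟨z, hz⟩ := h
  induction z using WithOne.cases_on
  ·
    have hz' : (b : WithOne X) = a := by simpa using hz
    rw [WithOne.coe_inj.mp hz']
  · rename_i p
    intro hz
    have hz' : ((b * a : X) : WithOne X) = p := hz
    rw [← WithOne.coe_inj.mp hz', map_mul]
    exact (bool_mul_le _ _).1

/-- For every idempotent `e` of a semigroup `X`, `√∞H_e ⊆ ⇕e`. -/
theorem stmt_2 {X : Type u} [Semigroup X] (e : X) (he : e * e = e) :
    rootInf (HClass e) ⊆ twoClass e := by
  rintro x ⟨n, hn, -⟩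
  have h1 : ∀ χ : X →ₙ* Bool, χ (spow x n) ≤ χ e := fun χ =>
    binLe_of_right χ _ _ (hn ▸ ⟨1, mul_one _⟩)
  have h2 : ∀ χ : X →ₙ* Bool, χ e ≤ χ (spow x n) := fun χ =>
    binLe_of_right χ _ _ (hn ▸ ⟨1, mul_one _⟩)
  refine ⟨fun χ => ?_, fun χ => ?_⟩
  · rw [← chi_spow χ x n]; exact h2 χ
  · rw [← chi_spow χ x n]; exact h1 χ
end

section
/- For every element x of a semigroup X, its 𝟐-class ⇕x = {y ∈ X : x ≲ y and y ≲ x} is a 𝟐-trivial subsemigroup of X, i.e., every semigroup homomorphism from ⇕x to 𝟐 is constant. -/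
universe u

theorem upClass_mul_iff {X : Type u} [Semigroup X] (x u v : X) :
    binLe x (u * v) ↔ binLe x u ∧ binLe x v := by
  have key : ∀ p q r : Bool, p ≤ q * r ↔ p ≤ q ∧ p ≤ r := by decide
  unfold binLe
  simp only [map_mul, key]
  exact forall_and

theorem twoClass_mul_right {X : Type u} [Semigroup X] {x a : X} (ha : a ∈ twoClass x) (u : X) :
    u * a ∈ twoClass x ↔ binLe x u := by
  have key : ∀ p q r : Bool, q ≤ p → r * q ≤ p := by decide
  constructor
  · intro h
    exact ((upClass_mul_iff x u a).1 h.1).1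
  · intro h
    refine ⟨(upClass_mul_iff x u a).2 ⟨h, ha.1⟩, fun χ => ?_⟩
    rw [map_mul]
    exact key _ _ _ (ha.2 χ)

theorem twoClass_mul_left {X : Type u} [Semigroup X] {x a : X} (ha : a ∈ twoClass x) (u : X) :
    a * u ∈ twoClass x ↔ binLe x u := by
  have key : ∀ p q r : Bool, q ≤ p → q * r ≤ p := by decide
  constructor
  · intro h
    exact ((upClass_mul_iff x a u).1 h.1).2
  · intro h
    refine ⟨(upClass_mul_iff x a u).2 ⟨ha.1, h⟩, fun χ => ?_⟩
    rw [map_mul]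
    exact key _ _ _ (ha.2 χ)

theorem twoClass_const {X : Type u} [Semigroup X] (x : X) (S : Subsemigroup X)
    (hS : (S : Set X) = twoClass x) (χ : S →ₙ* Bool) (a b : S) (h1 : χ a = true) :
    χ b = true := by
  classical
  have mem : ∀ y, y ∈ S ↔ y ∈ twoClass x := fun y => by rw [← hS]; rfl
  have hr : ∀ u, u * (a : X) ∈ S ↔ binLe x u := fun u => by
    rw [mem]; exact twoClass_mul_right ((mem _).1 a.2) u
  have hl : ∀ u, (a : X) * u ∈ S ↔ binLe x u := fun u => by
    rw [mem]; exact twoClass_mul_left ((mem _).1 a.2) u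
  have one_l : ∀ p : Bool, true * p = p := by decide
  have one_r : ∀ p : Bool, p * true = p := by decide
  have zero_l : ∀ p : Bool, false * p = false := by decide
  have zero_r : ∀ p : Bool, p * false = false := by decide
  have comm : ∀ (u : X) (h : u * (a : X) ∈ S) (h' : (a : X) * u ∈ S),
      χ ⟨u * a, h⟩ = χ ⟨a * u, h'⟩ := by
    intro u h h'
    have e : a * (⟨u * a, h⟩ : S) = (⟨a * u, h'⟩ : S) * a :=
      Subtype.ext (mul_assoc (a : X) u a).symm
    have := congrArg χ e
    rwa [map_mul, map_mul, h1, one_l, one_r] at this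
  let f : X → Bool := fun u => if h : u * (a : X) ∈ S then χ ⟨u * a, h⟩ else false
  have fmul : ∀ u v, f (u * v) = f u * f v := by
    intro u v
    by_cases hu : binLe x u
    · by_cases hv : binLe x v
      · have huv : binLe x (u * v) := (upClass_mul_iff x u v).2 ⟨hu, hv⟩
        simp only [f, dif_pos ((hr _).2 hu), dif_pos ((hr _).2 hv), dif_pos ((hr _).2 huv)]
        rw [comm u _ ((hl u).2 hu), ← map_mul]
        have e : (⟨a * u, (hl u).2 hu⟩ : S) * ⟨v * a, (hr v).2 hv⟩
            = a * ⟨u * v * a, (hr _).2 huv⟩ := Subtype.ext (by simp [mul_assoc])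
        rw [e, map_mul, h1, one_l]
      · have huv : ¬ binLe x (u * v) := fun h => hv ((upClass_mul_iff x u v).1 h).2
        simp only [f, dif_neg (fun h => hv ((hr _).1 h)), dif_neg (fun h => huv ((hr _).1 h)),
          zero_r]
    · have huv : ¬ binLe x (u * v) := fun h => hu ((upClass_mul_iff x u v).1 h).1
      simp only [f, dif_neg (fun h => hu ((hr _).1 h)), dif_neg (fun h => huv ((hr _).1 h)),
        zero_l]
  let φ : X →ₙ* Bool := ⟨f, fmul⟩
  have val : ∀ c : S, φ c = χ c := by
    intro c
    change f c = χ c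
    have hc : (c : X) * a ∈ S := S.mul_mem c.2 a.2
    simp only [f, dif_pos hc]
    have := map_mul χ c a
    rw [h1, one_r] at this
    exact this
  have hab : φ a ≤ φ b := le_trans (((mem _).1 a.2).2 φ) (((mem _).1 b.2).1 φ)
  rw [val, val, h1] at hab
  revert hab
  cases χ b <;> decide

/-- (Tamura) The `𝟐`-class `⇕x` of any element is a `𝟐`-trivial subsemigroup of `X`. -/
theorem stmt_3 {X : Type u} [Semigroup X] (x : X) :
    ∃ S : Subsemigroup X, (S : Set X) = twoClass x ∧
      ∀ χ : S →ₙ* Bool, ∀ a b : S, χ a = χ b := by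
  refine ⟨⟨twoClass x, fun {a b} ha hb => (twoClass_mul_left ha b).2 hb.1⟩, rfl, ?_⟩
  intro χ a b
  have h1 := twoClass_const x _ rfl χ a b
  have h2 := twoClass_const x _ rfl χ b a
  exact Bool.eq_iff_iff.2 ⟨h1, h2⟩
end

section
/- For any element x of a semigroup X, the upper 𝟐-class ⇑x = {y ∈ X : x ≲ y} coincides with the smallest prime coideal of X that contains x. -/
universe u

/-- The upper `𝟐`-class `⇑x` is the smallest prime coideal of `X` containing `x`. -/
theorem stmt_4 {X : Type u} [Semigroup X] (x : X) :
    IsPrimeCoideal (upClass x) ∧ x ∈ upClass x ∧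
      ∀ C : Set X, IsPrimeCoideal C → x ∈ C → upClass x ⊆ C := by
  have hmul : ∀ a b : Bool, a * b = (a && b) := by decide
  have hlam : ∀ (χ : X →ₙ* Bool) (a b : X), χ (a * b) = (χ a && χ b) := by
    intro χ a b
    rw [map_mul, hmul]
  have hle : ∀ a b : Bool, a ≤ b ↔ (a = true → b = true) := by decide
  refine ⟨⟨?_, ?_⟩, ?_, ?_⟩
  · intro a ha y
    refine ⟨fun h => ha ?_, fun h => ha ?_⟩
    · intro χ
      have := h χ
      rw [hle] at this ⊢
      rw [hlam, Bool.and_eq_true] at this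
      exact fun hx => (this hx).1
    · intro χ
      have := h χ
      rw [hle] at this ⊢
      rw [hlam, Bool.and_eq_true] at this
      exact fun hx => (this hx).2
  · intro a b ha hb χ
    have h1 := ha χ
    have h2 := hb χ
    rw [hle] at h1 h2 ⊢
    rw [hlam, Bool.and_eq_true]
    exact fun hx => ⟨h1 hx, h2 hx⟩
  · intro χ
    exact le_refl _
  · intro C hC hx y hy
    classical
    let χ : X →ₙ* Bool :=
      { toFun := fun z => decide (z ∈ C)
        map_mul' := by
          intro a b
          rw [hmul, ← Bool.decide_and]
          apply decide_eq_decide.2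
          constructor
          · intro h
            exact ⟨by_contra fun ha => (hC.1 a ha b).1 h, by_contra fun hb => (hC.1 b hb a).2 h⟩
          · exact fun h => hC.2 a b h.1 h.2 }
    have h := hy χ
    rw [hle] at h
    exact of_decide_eq_true (h (decide_eq_true hx))
end

section
/- For any element x of a semigroup X, the upper 𝟐-class ⇑x = {y ∈ X : x ≲ y} is equal to the union ⋃_{n∈ℕ} ⇑ₙx, where ⇑₀x = {x} and ⇑₍ₙ₊₁₎x = {y ∈ X : X¹yX¹ ∩ (⇑ₙx)² ≠ ∅} for each n (here (⇑ₙx)² = {ab : a, b ∈ ⇑ₙx} and X¹ is X with an identity adjoined). -/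
universe u

/-- The sets `⇑ₙx`: `⇑₀x = {x}` and
`⇑₍ₙ₊₁₎x = {y | X¹yX¹ ∩ (⇑ₙx)² ≠ ∅}` (computed in `X¹ = WithOne X`). -/
def upN {X : Type u} [Semigroup X] (x : X) : ℕ → Set X
  | 0 => {x}
  | n + 1 => {y | ∃ a b : WithOne X, ∃ u v : X, u ∈ upN x n ∧ v ∈ upN x n ∧
      a * (y : WithOne X) * b = ((u * v : X) : WithOne X)}

/-- The upper `𝟐`-class `⇑x` equals `⋃ₙ ⇑ₙx`. -/
theorem stmt_6 {X : Type u} [Semigroup X] (x : X) :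
    upClass x = ⋃ n : ℕ, upN x n := by
  classical
  have mono1 : ∀ n, upN x n ⊆ upN x (n + 1) := by
    intro n u hu
    exact ⟨1, (u : WithOne X), u, u, hu, hu, by simp⟩
  have mono : Monotone (upN x) := monotone_nat_of_le_succ mono1
  have hmul : ∀ y z : X, (y * z ∈ ⋃ n : ℕ, upN x n) ↔
      (y ∈ ⋃ n : ℕ, upN x n) ∧ (z ∈ ⋃ n : ℕ, upN x n) := by
    intro y z
    simp only [Set.mem_iUnion]
    constructor
    · rintro ⟨n, hn⟩
      refine ⟨⟨n + 1, 1, ((z * (y * z) : X) : WithOne X), _, _, hn, hn, ?_⟩,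
        ⟨n + 1, ((y * z * y : X) : WithOne X), 1, _, _, hn, hn, ?_⟩⟩
      · simp [mul_assoc]
      · simp [mul_assoc]
    · rintro ⟨⟨n, hn⟩, ⟨m, hm⟩⟩
      exact ⟨max n m + 1, 1, 1, y, z, mono (le_max_left n m) hn,
        mono (le_max_right n m) hm, by simp⟩
  have band : ∀ p q : Bool, p * q = (p && q) := by decide
  ext y
  constructor
  · intro hy
    let χ : X →ₙ* Bool :=
      { toFun := fun z => decide (z ∈ ⋃ n : ℕ, upN x n)
        map_mul' := by
          intro a b
          rw [band, ← Bool.decide_and]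
          exact decide_eq_decide.mpr (hmul a b) }
    have hx : χ x = true :=
      decide_eq_true (Set.mem_iUnion.mpr ⟨0, rfl⟩)
    have h := hy χ
    rw [hx] at h
    have h2 : χ y = true := h rfl
    exact of_decide_eq_true h2
  · intro hy χ
    obtain ⟨n, hn⟩ := Set.mem_iUnion.mp hy
    intro hx
    induction n generalizing y with
    | zero =>
      have : y = x := hn
      rw [this]; exact hx
    | succ n ih =>
      obtain ⟨a, b, u, v, hu, hv, e⟩ := hn
      have h1 := ih u (Set.mem_iUnion.mpr ⟨n, hu⟩) hu
      have h2 := ih v (Set.mem_iUnion.mpr ⟨n, hv⟩) hv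
      have h3 := congrArg (WithOne.lift χ) e
      simp only [map_mul, WithOne.lift_coe, h1, h2, band] at h3
      simp at h3
      exact h3.1.2
end

section
/- For any element a of a duo semigroup X, the upper 𝟐-class ⇑a equals {x ∈ X : aⁿ ∈ XxX for some positive integer n}. -/
universe u

theorem spow_add_aux {X : Type u} [Semigroup X] (a : X) (n m : ℕ) :
    spow a n * spow a m = spow a (n + m + 1) := by
  induction m with
  | zero => rfl
  | succ k ih =>
    change spow a n * (spow a k * a) = spow a (n + k + 1) * a
    rw [← mul_assoc, ih]

theorem spow_hom_aux {X : Type u} [Semigroup X] (χ : X →ₙ* Bool) (a : X) (h : χ a = true)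
    (n : ℕ) : χ (spow a n) = true := by
  induction n with
  | zero => exact h
  | succ k ih =>
    change χ (spow a k * a) = true
    rw [map_mul, ih, h]; rfl

theorem bool_mul_aux : ∀ p q : Bool, p * q = true ↔ p = true ∧ q = true := by decide

/-- For a duo semigroup, `⇑a = {x | aⁿ ∈ XxX for some n ≥ 1}`. -/
theorem stmt_7 {X : Type u} [Semigroup X] (hduo : IsDuo X) (a : X) :
    upClass a = {x | ∃ n : ℕ, ∃ u v : X, spow a n = u * x * v} := by
  classical
  ext x
  constructor
  · intro hx
    let P : X → Prop := fun x => ∃ n : ℕ, ∃ u v : X, spow a n = u * x * v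
    have hP : ∀ x y, P (x * y) ↔ P x ∧ P y := by
      intro x y
      constructor
      · rintro ⟨n, u, v, h⟩
        exact ⟨⟨n, u, y * v, by rw [h]; simp only [mul_assoc]⟩,
          ⟨n, u * x, v, by rw [h]; simp only [mul_assoc]⟩⟩
      · rintro ⟨⟨n, u, v, h⟩, ⟨m, u', v', h'⟩⟩
        have hm : (v * u') * y ∈ Set.range fun b : X => y * b := by
          rw [hduo y]; exact ⟨v * u', rfl⟩
        obtain ⟨w, hw⟩ := hm
        have hw' : y * w = v * u' * y := hw
        refine ⟨n + m + 1, u, w * v', ?_⟩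
        rw [← spow_add_aux, h, h']
        calc u * x * v * (u' * y * v') = u * x * (v * u' * y) * v' := by
              simp only [mul_assoc]
          _ = u * (x * y) * (w * v') := by rw [← hw']; simp only [mul_assoc]
    let χ : X →ₙ* Bool :=
      { toFun := fun x => decide (P x)
        map_mul' := by
          intro x y
          rw [Bool.eq_iff_iff, bool_mul_aux]
          simp only [decide_eq_true_eq]
          exact hP x y }
    have ha : χ a = true := decide_eq_true (p := P a) ⟨2, a, a, rfl⟩
    have h := hx χ
    rw [ha] at h
    have h2 : decide (P x) = true := h rfl
    exact of_decide_eq_true h2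
  · rintro ⟨n, u, v, h⟩ χ ha
    have h1 := spow_hom_aux χ a ha n
    rw [h, map_mul, map_mul, bool_mul_aux, bool_mul_aux] at h1
    exact h1.1.2
end

section
/- A duo semigroup X is 𝟐-trivial if and only if X is Archimedean, i.e., for any elements x, y ∈ X there exists a positive integer n such that xⁿ ∈ XyX. -/
universe u

theorem spow_mul_spow_aux {X : Type u} [Semigroup X] (x : X) (n m : ℕ) :
    spow x n * spow x m = spow x (n + m + 1) := by
  induction m with
  | zero => rfl
  | succ m ih =>
    show spow x n * (spow x m * x) = spow x (n + m + 1) * x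
    rw [← mul_assoc, ih]

theorem hom_spow_aux {X : Type u} [Semigroup X] (χ : X →ₙ* Bool) (x : X) (h : χ x = true) (n : ℕ) :
    χ (spow x n) = true := by
  induction n with
  | zero => exact h
  | succ n ih =>
    show χ (spow x n * x) = true
    rw [map_mul, ih, h]
    rfl

/-- (Tamura–Kimura) A duo semigroup is `𝟐`-trivial iff it is Archimedean. -/
theorem stmt_8 {X : Type u} [Semigroup X] (hduo : IsDuo X) :
    TwoTrivial X ↔ ∀ x y : X, ∃ n : ℕ, ∃ u v : X, spow x n = u * y * v := by
  constructor
  · intro ht x y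
    classical
    let C : X → Prop := fun y => ∃ n : ℕ, ∃ u v : X, spow x n = u * y * v
    have hC : ∀ a b, C (a * b) ↔ C a ∧ C b := by
      intro a b
      constructor
      · rintro ⟨n, u, v, h⟩
        exact ⟨⟨n, u, b * v, by simp only [h, mul_assoc]⟩,
          ⟨n, u * a, v, by simp only [h, mul_assoc]⟩⟩
      · rintro ⟨⟨n, u, v, h⟩, ⟨m, u', v', h'⟩⟩
        have hw : a * (v * u') ∈ Set.range fun z : X => z * a := by
          rw [← hduo a]
          exact ⟨_, rfl⟩
        obtain ⟨w, hw⟩ := hw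
        refine ⟨n + m + 1, u * w, v', ?_⟩
        rw [← spow_mul_spow_aux, h, h']
        calc u * a * v * (u' * b * v') = u * (a * (v * u')) * b * v' := by
              simp only [mul_assoc]
          _ = u * (w * a) * b * v' := by rw [← hw]
          _ = u * w * (a * b) * v' := by simp only [mul_assoc]
    let χ : X →ₙ* Bool :=
      { toFun := fun y => decide (C y)
        map_mul' := by
          intro a b
          have e : decide (C (a * b)) = (decide (C a) && decide (C b)) := by
            rw [← Bool.decide_and]
            exact decide_eq_decide.mpr (hC a b)
          exact e }
    have hx : C x := ⟨2, x, x, rfl⟩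
    have h1 : decide (C x) = decide (C y) := ht χ x y
    exact (decide_eq_decide.mp h1).mp hx
  · intro ha χ
    have key : ∀ a b, χ a = true → χ b = true := by
      intro a b h
      obtain ⟨n, u, v, e⟩ := ha a b
      have h2 := hom_spow_aux χ a h n
      rw [e, map_mul, map_mul] at h2
      have h3 : (χ u && χ b && χ v) = true := h2
      simp only [Bool.and_eq_true] at h3
      exact h3.1.2
    intro a b
    exact Bool.eq_iff_iff.mpr ⟨key a b, key b a⟩
end

section
/- If X is a viable semigroup, then for every idempotent e ∈ X the upper 𝟐-class ⇑e equals {x ∈ X : e ∈ X¹xX¹}, where X¹ is X with an identity adjoined. -/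
universe u

theorem viable_aux {X : Type u} [Semigroup X] (hv : Viable X) (e : X) (he : e * e = e) (x : X)
    (h : ∃ a b : WithOne X, a * (x : WithOne X) * b = (e : WithOne X)) :
    ∃ u : X, x * u = e ∧ u * x = e := by
  obtain ⟨a, b, hab⟩ := h
  have h1 : ∃ c : X, (c : WithOne X) = e * a := by
    cases a with
    | one => exact ⟨e, by simp⟩
    | coe a => exact ⟨e * a, by simp⟩
  have h2 : ∃ d : X, (d : WithOne X) = b * e := by
    cases b with
    | one => exact ⟨e, by simp⟩
    | coe b => exact ⟨b * e, by simp⟩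
  obtain ⟨c, hc⟩ := h1
  obtain ⟨d, hd⟩ := h2
  have hE : (e : WithOne X) * e = e := by rw [← WithOne.coe_mul, he]
  have hcxd : c * x * d = e := by
    apply WithOne.coe_injective
    rw [WithOne.coe_mul, WithOne.coe_mul, hc, hd]
    calc (e : WithOne X) * a * x * (b * e) = e * (a * x * b) * e := by simp only [mul_assoc]
      _ = e := by rw [hab, hE, hE]
  have hec : e * c = c := by
    apply WithOne.coe_injective
    rw [WithOne.coe_mul, hc, ← mul_assoc, hE]
  refine ⟨d * c, ?_, ?_⟩
  · have h3 : c * (x * d) = e := by rw [← mul_assoc, hcxd]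
    have h4 := hv c (x * d) (by rw [h3, he]) (by
      calc x * d * c * (x * d * c) = x * d * ((c * (x * d)) * c) := by simp only [mul_assoc]
        _ = x * d * c := by rw [h3, hec])
    rw [← mul_assoc, ← h4, h3]
  · have h4 := hv (c * x) d (by rw [hcxd, he]) (by
      calc d * (c * x) * (d * (c * x)) = d * ((c * x * d) * c * x) := by simp only [mul_assoc]
        _ = d * (c * x) := by rw [hcxd, hec])
    rw [mul_assoc, ← h4, hcxd]

/-- (Putcha–Weissglass) In a viable semigroup, `⇑e = {x | e ∈ X¹xX¹}` for every idempotent `e`. -/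
theorem stmt_9 {X : Type u} [Semigroup X] (hv : Viable X) (e : X) (he : e * e = e) :
     upClass e = {x : X | ∃ a b : WithOne X, a * (x : WithOne X) * b = (e : WithOne X)} := by
  classical
  ext x
  constructor
  · intro hx
    let P : X → Prop := fun x => ∃ a b : WithOne X, a * (x : WithOne X) * b = (e : WithOne X)
    have hP : ∀ x y, P (x * y) ↔ P x ∧ P y := by
      intro x y
      constructor
      · rintro ⟨a, b, h⟩
        rw [WithOne.coe_mul] at h
        exact ⟨⟨a, y * b, by rw [← h]; simp only [mul_assoc]⟩,
          ⟨a * x, b, by rw [← h]; simp only [mul_assoc]⟩⟩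
      · rintro ⟨hx, hy⟩
        obtain ⟨u, hu, hu'⟩ := viable_aux hv e he x hx
        obtain ⟨w, hw, hw'⟩ := viable_aux hv e he y hy
        refine ⟨1, ((w * u : X) : WithOne X), ?_⟩
        rw [one_mul, ← WithOne.coe_mul]
        congr 1
        calc x * y * (w * u) = x * (y * w) * u := by simp only [mul_assoc]
          _ = x * (u * x) * u := by rw [hw, hu']
          _ = (x * u) * (x * u) := by simp only [mul_assoc]
          _ = e := by rw [hu, he]
    let χ : X →ₙ* Bool :=
      { toFun := fun x => decide (P x)
        map_mul' := by
          intro x y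
          by_cases h1 : P x <;> by_cases h2 : P y <;> simp [hP, h1, h2] <;> rfl }
    have h : decide (P e) ≤ decide (P x) := hx χ
    have hPe : P e := ⟨1, 1, by simp⟩
    rw [decide_eq_true hPe] at h
    exact of_decide_eq_true (Bool.eq_true_of_true_le h)
  · intro h χ
    obtain ⟨u, hu, -⟩ := viable_aux hv e he x h
    rw [← hu, map_mul]
    generalize χ x = p
    generalize χ u = q
    revert p q
    decide
end

section
/- Let X be a unipotent 𝟐-trivial semigroup with unique idempotent e. Then the maximal subgroup H_e of e in X is an ideal in X. -/
universe u

/-- If `a x b = e`, then `x` has a two-sided inverse modulo `e`. -/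
theorem aux_inv {X : Type u} [Semigroup X] (e : X) (he : e * e = e)
    (huni : ∀ f : X, f * f = f → f = e) (a x b : X) (h : a * x * b = e) :
    ∃ y, x * y = e ∧ y * x = e := by
  have k1 : ∀ t, a * (x * (b * t)) = e * t := by
    intro t; rw [← h]; simp only [mul_assoc]
  have k2 : ∀ t, e * (e * t) = e * t := by
    intro t; rw [← mul_assoc, he]
  refine ⟨b * e * a, huni _ ?_, huni _ ?_⟩
  · simp only [mul_assoc, k1, k2]
  · simp only [mul_assoc, k1, k2]

theorem aux_all {X : Type u} [Semigroup X] (e : X) (he : e * e = e)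
    (huni : ∀ f : X, f * f = f → f = e) (htriv : TwoTrivial X) (x : X) :
    ∃ y, x * y = e ∧ y * x = e := by
  classical
  have comm : ∀ x : X, (∃ y, x * y = e ∧ y * x = e) → x * e = e * x := by
    rintro x ⟨y, h1, h2⟩
    calc x * e = x * (y * x) := by rw [h2]
      _ = e * x := by rw [← mul_assoc, h1]
  let χ : X →ₙ* Bool :=
    { toFun := fun x => decide (∃ y, x * y = e ∧ y * x = e)
      map_mul' := by
        intro p q
        change _ = (_ && _)
        rw [Bool.eq_iff_iff, Bool.and_eq_true, decide_eq_true_iff, decide_eq_true_iff,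
          decide_eq_true_iff]
        constructor
        · rintro ⟨y, h1, h2⟩
          constructor
          · refine aux_inv e he huni e p (q * y) ?_
            rw [mul_assoc, ← mul_assoc p, h1, he]
          · refine aux_inv e he huni (y * p) q e ?_
            rw [mul_assoc y, h2, he]
        · rintro ⟨hp, hq⟩
          obtain ⟨y, h1, h2⟩ := id hp
          obtain ⟨z, h3, h4⟩ := id hq
          refine aux_inv e he huni e (p * q) (z * y) ?_
          calc e * (p * q) * (z * y) = e * p * (q * z) * y := by simp only [mul_assoc]
            _ = e * (p * e) * y := by rw [h3]; simp only [mul_assoc]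
            _ = (e * e) * (p * y) := by rw [comm p hp]; simp only [mul_assoc]
            _ = e := by rw [h1, he, he] }
  have h := htriv χ x e
  have h' : χ e = true := decide_eq_true (⟨e, he, he⟩ : ∃ y, e * y = e ∧ y * e = e)
  rw [h'] at h
  exact of_decide_eq_true h

theorem aux_mem {X : Type u} [Semigroup X] (e w y : X)
    (h1 : w * y = e) (h2 : y * w = e) (h3 : e * w = w) (h4 : w * e = w) : w ∈ HClass e := by
  refine ⟨Set.Subset.antisymm ?_ ?_, Set.Subset.antisymm ?_ ?_⟩
  · rintro _ ⟨z, rfl⟩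
    exact ⟨w * z, by simp only []; rw [← mul_assoc, ← WithOne.coe_mul, h3]⟩
  · rintro _ ⟨z, rfl⟩
    exact ⟨y * z, by simp only []; rw [← mul_assoc, ← WithOne.coe_mul, h1]⟩
  · rintro _ ⟨z, rfl⟩
    exact ⟨z * w, by simp only []; rw [mul_assoc, ← WithOne.coe_mul, h4]⟩
  · rintro _ ⟨z, rfl⟩
    exact ⟨z * y, by simp only []; rw [mul_assoc, ← WithOne.coe_mul, h2]⟩

/-- (Tamura) For the unique idempotent `e` of a unipotent `𝟐`-trivial semigroup `X`,
the maximal subgroup `H_e` is an ideal in `X`. -/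
theorem stmt_10 {X : Type u} [Semigroup X] (e : X) (he : e * e = e)
    (huni : ∀ f : X, f * f = f → f = e) (htriv : TwoTrivial X) :
    IsIdealSet (HClass e) := by
  have comm : ∀ x : X, x * e = e * x := by
    intro x
    obtain ⟨y, h1, h2⟩ := aux_all e he huni htriv x
    calc x * e = x * (y * x) := by rw [h2]
      _ = e * x := by rw [← mul_assoc, h1]
  have key : ∀ w : X, e * w = w → w ∈ HClass e := by
    intro w hw
    obtain ⟨y, h1, h2⟩ := aux_all e he huni htriv w
    exact aux_mem e w y h1 h2 hw (by rw [comm, hw])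
  rintro a ⟨ha, -⟩ x
  have hea : e * a = a := by
    have hm : (a : WithOne X) ∈ Set.range fun z : WithOne X => (e : WithOne X) * z := by
      rw [← ha]; exact ⟨1, mul_one _⟩
    obtain ⟨z, hz⟩ := hm
    apply WithOne.coe_injective
    simp only [] at hz
    rw [WithOne.coe_mul, ← hz, ← mul_assoc, ← WithOne.coe_mul, he]
  refine ⟨key _ (by rw [← mul_assoc, hea]), key _ ?_⟩
  rw [← comm, mul_assoc, comm, hea]
end

section
/- The unique idempotent e of a unipotent 𝟐-trivial semigroup X is central in X, i.e., ex = xe for all x ∈ X. -/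
universe u

/-- The unique idempotent of a unipotent `𝟐`-trivial semigroup is central. -/
theorem stmt_11 {X : Type u} [Semigroup X] (e : X) (he : e * e = e)
    (huni : ∀ f : X, f * f = f → f = e) (htriv : TwoTrivial X) :
    ∀ x : X, e * x = x * e := by
  classical
  -- an element dividing `e` commutes with `e` and has an inverse relative to `e`
  have key : ∀ x : X, (∃ a b : X, a * x * b = e) → ∃ t, x * t = e ∧ t * x = e := by
    rintro x ⟨a, b, h⟩
    have h1 : (x * (b * e) * (e * a)) = e := by
      apply huni
      calc (x * (b * e) * (e * a)) * (x * (b * e) * (e * a))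
          = x * b * (e * e) * (a * x * b) * (e * e) * a := by simp only [mul_assoc]
        _ = x * b * (e * e) * (e * e) * e * a := by rw [h, he]
        _ = _ := by simp only [mul_assoc]; simp only [← mul_assoc e e, he]
    have h2 : ((b * e) * (e * a) * x) = e := by
      apply huni
      calc ((b * e) * (e * a) * x) * ((b * e) * (e * a) * x)
          = b * (e * e) * (a * x * b) * (e * e) * a * x := by simp only [mul_assoc]
        _ = b * (e * e) * (e * e) * e * a * x := by rw [h, he]
        _ = _ := by simp only [mul_assoc]; simp only [← mul_assoc e e, he]
    exact ⟨(b * e) * (e * a), by rw [← mul_assoc]; exact h1, h2⟩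
  have comm : ∀ x t : X, x * t = e → t * x = e → e * x = x * e := by
    intro x t h1 h2
    rw [← h1, mul_assoc, h2, h1]
  let C : X → Prop := fun x => ∃ a b : X, a * x * b = e
  have hC : ∀ x y, C (x * y) ↔ C x ∧ C y := by
    intro x y
    constructor
    · rintro ⟨a, b, h⟩
      exact ⟨⟨a, y * b, by rw [← h]; simp only [mul_assoc]⟩,
        ⟨a * x, b, by rw [← h]; simp only [mul_assoc]⟩⟩
    · rintro ⟨hx, hy⟩
      obtain ⟨t, h1, h2⟩ := key x hx
      obtain ⟨s, h3, h4⟩ := key y hy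
      refine ⟨e, s * t, ?_⟩
      calc e * (x * y) * (s * t) = e * (x * (y * s)) * t := by simp only [mul_assoc]
        _ = e := by rw [h3, ← comm x t h1 h2, ← mul_assoc, he, mul_assoc, h1, he]
  let χ : X →ₙ* Bool :=
    { toFun := fun x => decide (C x)
      map_mul' := fun x y => by
        change decide (C (x * y)) = (decide (C x) && decide (C y))
        rw [← Bool.decide_and]
        exact decide_eq_decide.mpr (hC x y) }
  intro x
  have hx : decide (C x) = decide (C e) := htriv χ x e
  have hCx : C x := (decide_eq_decide.mp hx).mpr ⟨e, e, by rw [he, he]⟩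
  obtain ⟨t, h1, h2⟩ := key x hCx
  exact comm x t h1 h2
end

section
/- For any idempotent e of a semigroup X, one has √∞H_e ⊆ H_e/e ⊆ ⇑e, where H_e/e = {x ∈ X : xe = ex ∈ H_e}; moreover H_e/e is a subsemigroup of X. -/
universe u

theorem mem_HClass_iff_aux {X : Type u} [Semigroup X] (e : X) (he : e * e = e) (x : X) :
    x ∈ HClass e ↔ e * x = x ∧ x * e = x ∧ (∃ y, x * y = e) ∧ (∃ z, z * x = e) := by
  constructor
  · rintro ⟨h1, h2⟩
    have a1 : (x : WithOne X) ∈ Set.range fun z : WithOne X => (e : WithOne X) * z :=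
      h1 ▸ ⟨1, mul_one _⟩
    have a2 : (e : WithOne X) ∈ Set.range fun z : WithOne X => (x : WithOne X) * z :=
      h1 ▸ ⟨1, mul_one _⟩
    have b1 : (x : WithOne X) ∈ Set.range fun z : WithOne X => z * (e : WithOne X) :=
      h2 ▸ ⟨1, one_mul _⟩
    have b2 : (e : WithOne X) ∈ Set.range fun z : WithOne X => z * (x : WithOne X) :=
      h2 ▸ ⟨1, one_mul _⟩
    obtain ⟨p, hp⟩ := a1
    obtain ⟨q, hq⟩ := a2
    obtain ⟨r, hr⟩ := b1
    obtain ⟨s, hs⟩ := b2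
    have he' : (e : WithOne X) * e = e := by rw [← WithOne.coe_mul, he]
    dsimp only at hp hq hr hs
    refine ⟨?_, ?_, ?_, ?_⟩
    · apply WithOne.coe_injective
      rw [WithOne.coe_mul, ← hp, ← mul_assoc, he']
    · apply WithOne.coe_injective
      rw [WithOne.coe_mul, ← hr, mul_assoc, he']
    · induction q using WithOne.recOneCoe with
      | one =>
        rw [mul_one] at hq
        exact ⟨e, by rw [WithOne.coe_injective hq, he]⟩
      | coe q => exact ⟨q, WithOne.coe_injective (by rw [WithOne.coe_mul, hq])⟩
    · induction s using WithOne.recOneCoe with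
      | one =>
        rw [one_mul] at hs
        exact ⟨e, by rw [WithOne.coe_injective hs, he]⟩
      | coe q => exact ⟨q, WithOne.coe_injective (by rw [WithOne.coe_mul, hs])⟩
  · rintro ⟨h1, h2, ⟨y, hy⟩, ⟨z, hz⟩⟩
    have g1 : (e : WithOne X) * x = x := by rw [← WithOne.coe_mul, h1]
    have g2 : (x : WithOne X) * e = x := by rw [← WithOne.coe_mul, h2]
    have g3 : (x : WithOne X) * y = e := by rw [← WithOne.coe_mul, hy]
    have g4 : (z : WithOne X) * x = e := by rw [← WithOne.coe_mul, hz]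
    constructor
    · apply Set.Subset.antisymm
      · rintro _ ⟨w, rfl⟩
        exact ⟨x * w, by dsimp only; rw [← mul_assoc, g1]⟩
      · rintro _ ⟨w, rfl⟩
        exact ⟨y * w, by dsimp only; rw [← mul_assoc, g3]⟩
    · apply Set.Subset.antisymm
      · rintro _ ⟨w, rfl⟩
        exact ⟨w * x, by dsimp only; rw [mul_assoc, g2]⟩
      · rintro _ ⟨w, rfl⟩
        exact ⟨w * z, by dsimp only; rw [mul_assoc, g4]⟩

theorem spow_comm_aux {X : Type u} [Semigroup X] (x : X) (n : ℕ) :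
    spow x n * x = x * spow x n := by
  induction n with
  | zero => rfl
  | succ n ih =>
    change spow x n * x * x = x * (spow x n * x)
    rw [← mul_assoc, ← ih]

/-- For any idempotent `e`: `√∞H_e ⊆ H_e/e ⊆ ⇑e`, and `H_e/e` is a subsemigroup of `X`. -/
theorem stmt_12 {X : Type u} [Semigroup X] (e : X) (he : e * e = e) :
    rootInf (HClass e) ⊆ HeOverE e ∧ HeOverE e ⊆ upClass e ∧
      ∀ x y : X, x ∈ HeOverE e → y ∈ HeOverE e → x * y ∈ HeOverE e := by
  refine ⟨?_, ?_, ?_⟩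
  · rintro x ⟨n, hn⟩
    have hc := spow_comm_aux x n
    have hn' := hn
    rw [mem_HClass_iff_aux e he] at hn
    obtain ⟨h1, h2, ⟨y, hy⟩, ⟨z, hz⟩⟩ := hn
    have k1 : e * x * e = e * x := by
      calc e * x * e = z * (spow x n * x) * e := by rw [← mul_assoc, hz]
        _ = z * (x * (spow x n * e)) := by rw [hc]; simp only [mul_assoc]
        _ = z * spow x n * x := by rw [h2, ← hc, mul_assoc]
        _ = e * x := by rw [hz]
    have k2 : e * x * e = x * e := by
      calc e * x * e = e * (x * spow x n) * y := by rw [← hy]; simp only [mul_assoc]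
        _ = e * spow x n * (x * y) := by rw [← hc]; simp only [mul_assoc]
        _ = x * (spow x n * y) := by rw [h1, ← mul_assoc, hc, mul_assoc]
        _ = x * e := by rw [hy]
    have k : x * e = e * x := k2.symm.trans k1
    refine ⟨k, ?_⟩
    cases n with
    | zero =>
      change e * x = x at h1
      rw [h1]
      exact hn'
    | succ n =>
      have hc' := spow_comm_aux x n
      rw [mem_HClass_iff_aux e he]
      refine ⟨by rw [← mul_assoc, he], k1, ⟨spow x n * y, ?_⟩, ⟨z * spow x n, ?_⟩⟩
      · change spow x n * x * y = e at hy
        rw [mul_assoc, ← mul_assoc x, ← hc', hy, he]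
      · change z * (spow x n * x) = e at hz
        rw [← k, mul_assoc, ← mul_assoc _ x, ← mul_assoc z, hz, he]
  · rintro x ⟨-, hx⟩ χ
    rw [mem_HClass_iff_aux e he] at hx
    obtain ⟨-, -, ⟨y, hy⟩, -⟩ := hx
    have h := congrArg χ hy
    rw [map_mul, map_mul] at h
    revert h
    generalize χ e = a
    generalize χ x = b
    generalize χ y = c
    revert a b c
    decide
  · rintro x y ⟨hx, hx'⟩ ⟨hy, hy'⟩
    rw [mem_HClass_iff_aux e he] at hx' hy'
    obtain ⟨-, -, ⟨x1, hx1⟩, ⟨x2, hx2⟩⟩ := hx'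
    obtain ⟨-, -, ⟨y1, hy1⟩, ⟨y2, hy2⟩⟩ := hy'
    have k : x * y * e = e * (x * y) := by
      rw [mul_assoc, hy, ← mul_assoc, hx, mul_assoc]
    refine ⟨k, ?_⟩
    rw [mem_HClass_iff_aux e he]
    refine ⟨by rw [← mul_assoc, he], by rw [mul_assoc, k, ← mul_assoc, he],
      ⟨y1 * x1, ?_⟩, ⟨y2 * x2, ?_⟩⟩
    · calc e * (x * y) * (y1 * x1) = e * x * y * y1 * x1 := by simp only [mul_assoc]
        _ = x * (e * y * y1) * x1 := by rw [← hx]; simp only [mul_assoc]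
        _ = e := by rw [hy1, hx, hx1]
    · calc y2 * x2 * (e * (x * y)) = y2 * (x2 * (e * x)) * y := by simp only [mul_assoc]
        _ = e := by rw [hx2, mul_assoc, hy2]
end

section
/- For a semigroup X the following conditions are equivalent: (1) X is E-separated; (2) X is E-viable; (3) X is E⇑-central; (4) X is E-hypercentral; (5) X is viable. -/
universe u

lemma mem_HClass_iff {X : Type u} [Semigroup X] {e : X} (he : e * e = e) (x : X) :
    x ∈ HClass e ↔ e * x = x ∧ x * e = x ∧ ∃ c, e * c = c ∧ c * e = c ∧ x * c = e ∧ c * x = e := by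
  constructor
  · rintro ⟨h1, h2⟩
    have a1 : (x : WithOne X) ∈ Set.range fun z : WithOne X => (e : WithOne X) * z := by
      rw [← h1]; exact ⟨1, mul_one _⟩
    have a2 : (x : WithOne X) ∈ Set.range fun z : WithOne X => z * (e : WithOne X) := by
      rw [← h2]; exact ⟨1, one_mul _⟩
    have a3 : (e : WithOne X) ∈ Set.range fun z : WithOne X => (x : WithOne X) * z := by
      rw [h1]; exact ⟨1, mul_one _⟩
    have a4 : (e : WithOne X) ∈ Set.range fun z : WithOne X => z * (x : WithOne X) := by
      rw [h2]; exact ⟨1, one_mul _⟩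
    have he' : (e : WithOne X) * e = e := by exact_mod_cast he
    have b1 : e * x = x := by
      obtain ⟨z, hz⟩ := a1
      have : (e : WithOne X) * x = x := by
        rw [← hz]; simp only [← mul_assoc, he']
      exact_mod_cast this
    have b2 : x * e = x := by
      obtain ⟨z, hz⟩ := a2
      have : (x : WithOne X) * e = x := by
        rw [← hz]; simp only [mul_assoc, he']
      exact_mod_cast this
    have b3 : ∃ p : X, x * p = e := by
      obtain ⟨z, hz⟩ := a3
      by_cases hz1 : z = 1
      · subst hz1
        have : x = e := by
          have : (x : WithOne X) = e := by simpa using hz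
          exact_mod_cast this
        exact ⟨e, by rw [this, he]⟩
      · obtain ⟨p, rfl⟩ := WithOne.ne_one_iff_exists.1 hz1
        exact ⟨p, WithOne.coe_inj.1 (by simpa using hz)⟩
    have b4 : ∃ p : X, p * x = e := by
      obtain ⟨z, hz⟩ := a4
      by_cases hz1 : z = 1
      · subst hz1
        have : x = e := by
          have : (x : WithOne X) = e := by simpa using hz
          exact_mod_cast this
        exact ⟨e, by rw [this, he]⟩
      · obtain ⟨p, rfl⟩ := WithOne.ne_one_iff_exists.1 hz1
        exact ⟨p, WithOne.coe_inj.1 (by simpa using hz)⟩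
    obtain ⟨p, hp⟩ := b3
    obtain ⟨q, hq⟩ := b4
    have k : e * p = q * e := by rw [← hq, mul_assoc, hp, hq]
    refine ⟨b1, b2, e * p, by rw [← mul_assoc, he], by rw [k, mul_assoc, he], by
      rw [← mul_assoc, b2, hp], by rw [k, mul_assoc, b1, hq]⟩
  · rintro ⟨b1, b2, c, -, -, c1, c2⟩
    have B1 : (e : WithOne X) * x = x := by exact_mod_cast b1
    have B2 : (x : WithOne X) * e = x := by exact_mod_cast b2
    have C1 : (x : WithOne X) * c = e := by exact_mod_cast c1
    have C2 : (c : WithOne X) * x = e := by exact_mod_cast c2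
    constructor
    · ext w
      constructor
      · rintro ⟨z, rfl⟩
        exact ⟨x * z, by simp only [← mul_assoc, B1]⟩
      · rintro ⟨z, rfl⟩
        exact ⟨c * z, by simp only [← mul_assoc, C1]⟩
    · ext w
      constructor
      · rintro ⟨z, rfl⟩
        exact ⟨z * x, by simp only [mul_assoc, B2]⟩
      · rintro ⟨z, rfl⟩
        exact ⟨z * c, by simp only [mul_assoc, C2]⟩

lemma viable_key {X : Type u} [Semigroup X] (h : Viable X) {e x y : X} (he : e * e = e)
    (hxy : x * y = e) : y * e * x = e := by
  have h1 : x * (y * e) = e := by rw [← mul_assoc, hxy, he]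
  have h2 := h x (y * e) (by rw [h1, he]) (by
    calc y * e * x * (y * e * x) = y * e * (x * (y * e)) * x := by simp only [mul_assoc]
      _ = y * e * x := by rw [h1, mul_assoc y, he])
  rw [← h2, h1]

lemma viable_hyper {X : Type u} [Semigroup X] (h : Viable X) : EHypercentral X := by
  intro e x y he hxy
  have k := viable_key h he hxy
  constructor
  · calc x * e = x * (y * e * x) := by rw [k]
      _ = (x * y) * e * x := by simp only [mul_assoc]
      _ = e * x := by rw [hxy, he]
  · calc y * e = y * e * (x * y) := by rw [hxy, mul_assoc, he]
      _ = (y * e * x) * y := by simp only [mul_assoc]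
      _ = e * y := by rw [k]

lemma hyper_viable {X : Type u} [Semigroup X] (h : EHypercentral X) : Viable X := by
  intro x y he hf
  obtain ⟨a1, a2⟩ := h _ x y he rfl
  obtain ⟨b1, b2⟩ := h _ y x hf rfl
  calc x * y = x * (y * x) * y := by simp only [mul_assoc] at he ⊢; rw [he]
    _ = y * x * (x * y) := by rw [b2]; simp only [mul_assoc]
    _ = y * (x * (x * y)) := by simp only [mul_assoc]
    _ = y * (x * y * x) := by rw [a1]
    _ = y * x * (y * x) := by simp only [mul_assoc]
    _ = y * x := hf

lemma viable_EViable {X : Type u} [Semigroup X] (h : Viable X) : EViable X := by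
  intro e he
  have main : ∀ a b : X, a * b ∈ HeOverE e → a ∈ HeOverE e ∧ b ∈ HeOverE e := by
    rintro a b ⟨hc, hH⟩
    rw [mem_HClass_iff he] at hH
    obtain ⟨-, -, c, c1, c2, c3, c4⟩ := hH
    have p1 : a * (b * c) = e := by
      rw [← c1, ← mul_assoc, ← mul_assoc, hc, c3]
    have p2 : (c * a) * b = e := by
      rw [← c2, mul_assoc, mul_assoc, c4]
    have q1 := viable_hyper h e _ _ he p1
    have q2 := viable_hyper h e _ _ he p2
    have k1 := viable_key h he p1
    have k2 := viable_key h he p2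
    refine ⟨⟨q1.1, (mem_HClass_iff he _).2 ⟨?_, ?_, e * (b * c), ?_, ?_, ?_, ?_⟩⟩,
      ⟨q2.2, (mem_HClass_iff he _).2 ⟨?_, ?_, e * (c * a), ?_, ?_, ?_, ?_⟩⟩⟩
    · rw [← mul_assoc, he]
    · rw [mul_assoc, q1.1, ← mul_assoc, he]
    · rw [← mul_assoc, he]
    · rw [mul_assoc, q1.2, ← mul_assoc, he]
    · rw [← q1.2, ← mul_assoc, mul_assoc e a, p1, he, he]
    · rw [← q1.2, ← mul_assoc, mul_assoc _ e e, he, k1]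
    · rw [← mul_assoc, he]
    · rw [mul_assoc, q2.2, ← mul_assoc, he]
    · rw [← mul_assoc, he]
    · rw [mul_assoc, q2.1, ← mul_assoc, he]
    · rw [← q2.2, ← mul_assoc, mul_assoc _ e e, he, k2]
    · rw [← q2.2, ← mul_assoc, mul_assoc e _ b, p2, he, he]
  intro a ha x
  exact ⟨fun hh => ha (main _ _ hh).1, fun hh => ha (main _ _ hh).2⟩

lemma HeOverE_mul {X : Type u} [Semigroup X] {e : X} (he : e * e = e) {a b : X}
    (ha : a ∈ HeOverE e) (hb : b ∈ HeOverE e) : a * b ∈ HeOverE e := by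
  obtain ⟨a1, a2⟩ := ha
  obtain ⟨b1, b2⟩ := hb
  rw [mem_HClass_iff he] at a2 b2
  obtain ⟨-, -, c, c1, c2, c3, c4⟩ := a2
  obtain ⟨-, -, d, d1, d2, d3, d4⟩ := b2
  have k : a * b * e = e * (a * b) := by rw [mul_assoc, b1, ← mul_assoc, a1, mul_assoc]
  refine ⟨k, (mem_HClass_iff he _).2 ⟨?_, ?_, d * c, ?_, ?_, ?_, ?_⟩⟩
  · rw [← mul_assoc, he]
  · rw [mul_assoc, k, ← mul_assoc, he]
  · rw [← mul_assoc, d1]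
  · rw [mul_assoc, c2]
  · calc e * (a * b) * (d * c) = e * a * (b * d) * c := by simp only [mul_assoc]
      _ = a * (e * b * d) * c := by rw [← a1]; simp only [mul_assoc]
      _ = e := by rw [d3, a1, c3]
  · calc d * c * (e * (a * b)) = d * (c * (e * a)) * b := by simp only [mul_assoc]
      _ = d * (e * b) := by rw [c4, mul_assoc]
      _ = e := d4

lemma self_mem {X : Type u} [Semigroup X] {e : X} (he : e * e = e) : e ∈ HeOverE e :=
  ⟨rfl, by rw [he]; exact ⟨rfl, rfl⟩⟩

lemma exists_char {X : Type u} [Semigroup X] (h : EViable X) {e : X} (he : e * e = e) :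
    ∃ χ : X →ₙ* Bool, ∀ x, χ x = true ↔ x ∈ HeOverE e := by
  classical
  refine ⟨⟨fun x => decide (x ∈ HeOverE e), fun a b => ?_⟩, fun x => by simp⟩
  have key : a * b ∈ HeOverE e ↔ a ∈ HeOverE e ∧ b ∈ HeOverE e := by
    refine ⟨fun hh => ⟨?_, ?_⟩, fun hh => HeOverE_mul he hh.1 hh.2⟩
    · by_contra ha
      exact (h e he a ha b).1 hh
    · by_contra hb
      exact (h e he b hb a).2 hh
  change decide _ = (decide _ && decide _)
  rw [← Bool.decide_and]
  simp only [key]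

lemma idem_eq {X : Type u} [Semigroup X] {e f : X} (he : e * e = e) (hf : f * f = f)
    (h : f ∈ HeOverE e) : e * f = e := by
  obtain ⟨h1, h2⟩ := h
  rw [mem_HClass_iff he] at h2
  obtain ⟨-, h4, c, -, -, c3, -⟩ := h2
  have : e * f * (e * f) = e * f := by rw [← mul_assoc, h4, mul_assoc, hf]
  calc e * f = e * f * (e * f * c) := by rw [c3, h4]
    _ = e := by rw [← mul_assoc, this, c3]

theorem stmt_14 {X : Type u} [Semigroup X] :
    List.TFAE [ESeparated X, EViable X, EUpArrowCentral X, EHypercentral X, Viable X] := by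
  tfae_have 5 → 2 := viable_EViable
  tfae_have 4 → 5 := hyper_viable
  tfae_have 2 → 3 := by
    intro h e he x hx
    obtain ⟨χ, hχ⟩ := exists_char h he
    have h1 := hx χ
    rw [(hχ e).2 (self_mem he)] at h1
    exact ((hχ x).1 (top_le_iff.1 h1)).1.symm
  tfae_have 3 → 4 := by
    intro h e x y he hxy
    refine ⟨(h e he x fun χ => ?_).symm, (h e he y fun χ => ?_).symm⟩
    · rw [← hxy, map_mul]
      exact inf_le_left
    · rw [← hxy, map_mul]
      exact inf_le_right
  tfae_have 1 → 5 := by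
    intro h x y hx hy
    by_contra hne
    obtain ⟨Y, mul, f, -, h2, -, h4, h5⟩ := h _ _ hx hy hne
    exact h5 (by rw [h4, h4, h2])
  tfae_have 2 → 1 := by
    intro h e f he hf hne
    have sep : ∀ χ : X →ₙ* Bool, χ e ≠ χ f →
        ∃ (Y : Type u) (mul : Y → Y → Y) (h : X → Y),
          (∀ a b c : Y, mul (mul a b) c = mul a (mul b c)) ∧
          (∀ a b : Y, mul a b = mul b a) ∧
          (∀ a : Y, mul a a = a) ∧
          (∀ a b : X, h (a * b) = mul (h a) (h b)) ∧
          h e ≠ h f := by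
      intro χ hχ
      refine ⟨ULift Bool, fun a b => ⟨a.down && b.down⟩, fun x => ⟨χ x⟩, ?_, ?_, ?_, ?_, ?_⟩
      · intro a b c; simp [Bool.and_assoc]
      · intro a b; simp [Bool.and_comm]
      · intro a; simp
      · intro a b; simp only [map_mul]; rfl
      · intro hh; exact hχ (congrArg ULift.down hh)
    obtain ⟨χ, hχ⟩ := exists_char h he
    obtain ⟨ψ, hψ⟩ := exists_char h hf
    by_cases h1 : χ e = χ f
    · by_cases h2 : ψ e = ψ f
      · exfalso
        have m1 : f ∈ HeOverE e := (hχ f).1 (h1 ▸ (hχ e).2 (self_mem he))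
        have m2 : e ∈ HeOverE f := (hψ e).1 (h2 ▸ (hψ f).2 (self_mem hf))
        apply hne
        rw [← idem_eq he hf m1, ← m1.1, idem_eq hf he m2]
      · exact sep ψ h2
    · exact sep χ h1
  tfae_finish
end

section
/- Every E-separated semigroup X is both E-hypocentral and E-upcentral. -/
universe u

theorem hyper_aux {X : Type u} [Semigroup X] (hsep : ESeparated X) (e x y : X)
    (he : e * e = e) (hxy : x * y = e) : x * e = e * x ∧ y * e = e * y := by
  have key : y * e * x = e := by
    by_contra hne
    have hid : (y * e * x) * (y * e * x) = y * e * x := by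
      calc (y * e * x) * (y * e * x) = y * (e * (x * y) * e) * x := by simp only [mul_assoc]
        _ = y * e * x := by rw [hxy, he, he]
    obtain ⟨Y, m, h, ha, hc, hi, hm, hn⟩ := hsep _ _ hid he hne
    apply hn
    rw [hm, hm, hc (h y), ha, hc (h y), ← hm x y, hxy, hi]
  constructor
  · calc x * e = x * (y * e * x) := by rw [key]
      _ = (x * y) * e * x := by simp only [mul_assoc]
      _ = e * x := by rw [hxy, he]
  · calc y * e = y * (e * e) := by rw [he]
      _ = y * (e * (x * y)) := by rw [hxy]
      _ = (y * e * x) * y := by simp only [mul_assoc]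
      _ = e * y := by rw [key]

theorem spow_aux {X : Type u} [Semigroup X] (x e : X) (m : ℕ) :
    ∀ w, spow x m * w = e → ∃ w', x * w' = e := by
  induction m with
  | zero => exact fun w h => ⟨w, h⟩
  | succ k ih => exact fun w h => ih (x * w) (by rw [← h, spow, mul_assoc])

/-- Every `E`-separated semigroup is `E`-hypocentral and `E`-upcentral. -/
theorem stmt_15 {X : Type u} [Semigroup X] (hsep : ESeparated X) :
    EHypocentral X ∧ EUpcentral X := by
  refine ⟨fun e x y he hxy => Or.inl (hyper_aux hsep e x y he hxy).1, ?_⟩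
  rintro e f he hf hfe hef x ⟨n, hn, -⟩
  have hmem : (f : WithOne X) ∈ Set.range fun z : WithOne X => (f : WithOne X) * z :=
    ⟨1, mul_one _⟩
  rw [← hn] at hmem
  obtain ⟨z, hz⟩ := hmem
  have hw : ∃ w, spow x n * w = e := by
    rcases WithOne.cases_on (P := fun z => z = 1 ∨ ∃ a : X, z = (a : WithOne X)) z (Or.inl rfl)
      (fun a => Or.inr ⟨a, rfl⟩) with rfl | ⟨a, rfl⟩
    · refine ⟨e, ?_⟩
      have h1 : spow x n = f := by
        apply WithOne.coe_injective
        simpa using hz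
      rw [h1, hfe]
    · refine ⟨a * e, ?_⟩
      have h1 : spow x n * a = f := by
        apply WithOne.coe_injective
        simpa using hz
      rw [← mul_assoc, h1, hfe]
  obtain ⟨w, hw⟩ := hw
  obtain ⟨w', hw'⟩ := spow_aux x e n w hw
  exact (hyper_aux hsep e x w' he hw').1
end

section
/- Every duo semigroup X is an E-separated E-semigroup; that is, the set E(X) of idempotents of X is closed under multiplication, and for any distinct idempotents x, y ∈ X there exists a semigroup homomorphism h from X to a semilattice with h(x) ≠ h(y). -/
universe u

/-- Every duo semigroup is an `E`-separated `E`-semigroup. -/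
theorem stmt_16 {X : Type u} [Semigroup X] (hduo : IsDuo X) :
    (∀ e f : X, e * e = e → f * f = f → (e * f) * (e * f) = e * f) ∧ ESeparated X := by
  have h1 : ∀ x a : X, ∃ b, x * a = b * x := by
    intro x a
    have h : x * a ∈ Set.range fun a : X => a * x := by
      rw [← hduo x]
      exact ⟨a, rfl⟩
    obtain ⟨b, hb⟩ := h
    exact ⟨b, hb.symm⟩
  have h2 : ∀ x a : X, ∃ b, a * x = x * b := by
    intro x a
    have h : a * x ∈ Set.range fun a : X => x * a := by
      rw [hduo x]
      exact ⟨a, rfl⟩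
    obtain ⟨b, hb⟩ := h
    exact ⟨b, hb.symm⟩
  have hc : ∀ e x : X, e * e = e → e * x = x * e := by
    intro e x he
    obtain ⟨b, hb⟩ := h1 e x
    obtain ⟨c, hc⟩ := h2 e x
    have k1 : e * x * e = e * x := by rw [hb, mul_assoc, he]
    have k2 : e * (x * e) = x * e := by rw [hc, ← mul_assoc, he]
    rw [← k1, mul_assoc, k2]
  refine ⟨?_, ?_⟩
  · intro e f he hf
    rw [mul_assoc, ← mul_assoc f e f, ← hc e f he, mul_assoc e f f, hf, ← mul_assoc, he]
  · intro x y hx hy hxy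
    refine ⟨Set X, fun A B => A ∩ B, fun z => {e | e * e = e ∧ ∃ a, e = z * a},
      Set.inter_assoc, Set.inter_comm, Set.inter_self, ?_, ?_⟩
    · intro a b
      ext e
      constructor
      · rintro ⟨he, z, hz⟩
        refine ⟨⟨he, b * z, by rw [hz, mul_assoc]⟩, he, ?_⟩
        obtain ⟨v, hv⟩ := h2 (b * z) a
        exact ⟨z * v, by rw [hz, mul_assoc, hv, mul_assoc]⟩
      · rintro ⟨⟨he, z, hz⟩, -, w, hw⟩
        refine ⟨he, w * z, ?_⟩
        calc e = (a * z) * e := by rw [← hz, he]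
          _ = a * (e * z) := by rw [mul_assoc, hc e z he]
          _ = a * b * (w * z) := by rw [hw]; simp only [mul_assoc]
    · intro h
      simp only at h
      have k1 : x ∈ {e : X | e * e = e ∧ ∃ a, e = y * a} := by
        rw [← h]
        exact ⟨hx, x, hx.symm⟩
      have k2 : y ∈ {e : X | e * e = e ∧ ∃ a, e = x * a} := by
        rw [h]
        exact ⟨hy, y, hy.symm⟩
      obtain ⟨-, a, ha⟩ := k1
      obtain ⟨-, b, hb⟩ := k2
      apply hxy
      have e1 : y * x = x := by rw [ha, ← mul_assoc, hy]
      have e2 : x * y = y := by rw [hb, ← mul_assoc, hx]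
      rw [← e1, ← hc x y hx, e2]
end

section
/- Let X be an E-separated E-semigroup and let ⇕E(X) = ⋃_{e∈E(X)} ⇕e. Then: (1) the map π⇕ : ⇕E(X) → E(X) assigning to each x ∈ ⇕E(X) the unique idempotent lying in ⇕x is a well-defined homomorphic retraction of the semigroup ⇕E(X) onto E(X); (2) the map ℏ⇕ : ⇕E(X) → H(X), ℏ⇕(x) = x·π⇕(x), is a well-defined homomorphic retraction of ⇕E(X) onto the Clifford part H(X) = ⋃_{e∈E(X)} H_e; (3) H(X) is a subsemigroup of X. -/
universe u

theorem aux_mulBool (a b : Bool) : a * b = (a && b) := by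
  cases a <;> cases b <;> rfl

open Classical in
theorem aux_char {X : Type u} [Semigroup X] (C : Set X)
    (hC : ∀ a b : X, a * b ∈ C ↔ a ∈ C ∧ b ∈ C) :
    ∃ χ : X →ₙ* Bool, ∀ x, χ x = true ↔ x ∈ C := by
  refine ⟨⟨fun x => decide (x ∈ C), ?_⟩, ?_⟩
  · intro a b
    rw [aux_mulBool, ← Bool.decide_and]
    exact decide_eq_decide.2 (hC a b)
  · intro x
    exact decide_eq_true_iff

theorem aux_binLe {X : Type u} [Semigroup X] {x y : X} :
    binLe x y ↔ ∀ χ : X →ₙ* Bool, χ x = true → χ y = true := by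
  unfold binLe
  refine forall_congr' fun χ => ?_
  cases χ x <;> cases χ y <;> decide

theorem aux_map {X : Type u} [Semigroup X] (χ : X →ₙ* Bool) (a b : X) :
    χ (a * b) = true ↔ χ a = true ∧ χ b = true := by
  rw [map_mul, aux_mulBool, Bool.and_eq_true]

theorem aux_two {X : Type u} [Semigroup X] {a x : X} :
    x ∈ twoClass a ↔ ∀ χ : X →ₙ* Bool, χ x = true ↔ χ a = true := by
  unfold twoClass
  simp only [Set.mem_setOf_eq, aux_binLe]
  exact ⟨fun h χ => ⟨h.2 χ, h.1 χ⟩, fun h => ⟨fun χ => (h χ).2, fun χ => (h χ).1⟩⟩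

theorem aux_uniq {X : Type u} [Semigroup X] (hsep : ESeparated X) {x y : X}
    (hx : x * x = x) (hy : y * y = y)
    (h : ∀ χ : X →ₙ* Bool, χ x = true ↔ χ y = true) : x = y := by
  by_contra hne
  obtain ⟨Y, mul, g, as, cm, idem, hg, hgne⟩ := hsep x y hx hy hne
  have key : ∀ w : X, ∃ χ : X →ₙ* Bool, ∀ v, χ v = true ↔ mul (g v) (g w) = g w := by
    intro w
    refine aux_char {v | mul (g v) (g w) = g w} ?_
    intro a b
    simp only [Set.mem_setOf_eq, hg]
    constructor
    · intro h
      constructor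
      · rw [← h, ← as, ← as, idem]
      · rw [← h, cm (g a), ← as, ← as, idem]
    · rintro ⟨h1, h2⟩
      rw [as, h2, h1]
  obtain ⟨χ, hχ⟩ := key x
  obtain ⟨ψ, hψ⟩ := key y
  have h1 := (hχ y).1 ((h χ).1 ((hχ x).2 (idem _)))
  have h2 := (hψ x).1 ((h ψ).2 ((hψ y).2 (idem _)))
  exact hgne (by rw [← h1, cm, h2])

theorem aux_core {X : Type u} [Semigroup X] (hsep : ESeparated X) {e x a b : X}
    (he : e * e = e) (h : a * x * b = e) :
    x * e = e * x ∧ ∃ z, z * x = e ∧ x * z = e := by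
  have hχ : ∀ χ : X →ₙ* Bool, χ e = true ↔ (χ a = true ∧ χ x = true) ∧ χ b = true := by
    intro χ
    rw [← aux_map, ← aux_map, h]
  have h1 : b * e * a * x = e := by
    refine aux_uniq hsep ?_ he ?_
    · calc b * e * a * x * (b * e * a * x) = b * e * (a * x * b) * e * a * x := by
            simp only [mul_assoc]
        _ = b * (e * e * e) * a * x := by rw [h]; simp only [mul_assoc]
        _ = _ := by rw [he, he]
    · intro χ
      have := hχ χ
      simp only [aux_map]
      tauto
  have h2 : x * (b * e * a) = e := by
    refine aux_uniq hsep ?_ he ?_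
    · calc x * (b * e * a) * (x * (b * e * a)) = x * b * e * (a * x * b) * e * a := by
            simp only [mul_assoc]
        _ = x * (b * (e * e * e) * a) := by rw [h]; simp only [mul_assoc]
        _ = _ := by rw [he, he]
    · intro χ
      have := hχ χ
      simp only [aux_map]
      tauto
  refine ⟨?_, _, h1, h2⟩
  calc x * e = x * (b * e * a * x) := by rw [h1]
    _ = x * (b * e * a) * x := by simp only [mul_assoc]
    _ = e * x := by rw [h2]

theorem aux_up {X : Type u} [Semigroup X] (hsep : ESeparated X) {e x : X}
    (he : e * e = e) (h : ∀ χ : X →ₙ* Bool, χ e = true → χ x = true) :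
    x * e = e * x ∧ ∃ z, z * x = e ∧ x * z = e := by
  obtain ⟨χ, hχ⟩ := aux_char {x : X | ∃ a b, a * x * b = e} (by
    intro x y
    simp only [Set.mem_setOf_eq]
    constructor
    · rintro ⟨a, b, h⟩
      exact ⟨⟨a, y * b, by rw [← h]; simp only [mul_assoc]⟩,
        ⟨a * x, b, by rw [← h]; simp only [mul_assoc]⟩⟩
    · rintro ⟨⟨a, b, h⟩, ⟨c, d, h'⟩⟩
      obtain ⟨-, z, hz, -⟩ := aux_core hsep he h
      obtain ⟨hc, w, -, hw⟩ := aux_core hsep he h'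
      refine ⟨z, w * e, ?_⟩
      calc z * (x * y) * (w * e) = z * x * (y * w) * e := by simp only [mul_assoc]
        _ = e := by rw [hz, hw, he, he])
  obtain ⟨a, b, hab⟩ := (hχ x).1 (h χ ((hχ e).2 ⟨e, e, by rw [he, he]⟩))
  exact aux_core hsep he hab

theorem aux_memH {X : Type u} [Semigroup X] (hsep : ESeparated X) {e x : X}
    (he : e * e = e) (h : ∀ χ : X →ₙ* Bool, χ e = true → χ x = true) :
    x * e ∈ HClass e := by
  obtain ⟨hc, z, hz, hz'⟩ := aux_up hsep he h
  have l : z * (x * e) = e := by rw [← mul_assoc, hz, he]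
  have r : (x * e) * z = e := by rw [hc, mul_assoc, hz', he]
  have c (a b : X) : ((a * b : X) : WithOne X) = a * b := WithOne.coe_mul a b
  constructor
  · ext w
    constructor
    · rintro ⟨v, rfl⟩
      exact ⟨x * v, by simp only [hc, c, mul_assoc]⟩
    · rintro ⟨v, rfl⟩
      exact ⟨z * v, by simp only [← mul_assoc]; rw [← c, r]⟩
  · ext w
    constructor
    · rintro ⟨v, rfl⟩
      exact ⟨v * x, by simp only [c, mul_assoc]⟩
    · rintro ⟨v, rfl⟩
      exact ⟨v * z, by simp only [mul_assoc]; rw [← c z, l]⟩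

theorem aux_ofH {X : Type u} [Semigroup X] {e x : X}
    (he : e * e = e) (h : x ∈ HClass e) :
    x * e = x ∧ ∀ χ : X →ₙ* Bool, χ x = true ↔ χ e = true := by
  obtain ⟨h1, h2⟩ := h
  have c (a b : X) : ((a * b : X) : WithOne X) = a * b := WithOne.coe_mul a b
  have hxe : x * e = x := by
    obtain ⟨v, hv⟩ : (x : WithOne X) ∈ Set.range fun z : WithOne X => z * (e : WithOne X) := by
      rw [← h2]; exact ⟨1, one_mul _⟩
    apply WithOne.coe_injective
    rw [c, ← hv]
    simp only [mul_assoc]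
    rw [← c, he]
  refine ⟨hxe, fun χ => ⟨fun hx => ?_, fun hx => ?_⟩⟩
  · rw [← hxe, aux_map] at hx
    exact hx.2
  · obtain ⟨v, hv⟩ : (e : WithOne X) ∈ Set.range fun z : WithOne X => (x : WithOne X) * z := by
      rw [h1]; exact ⟨1, mul_one _⟩
    cases v with
    | one =>
      have : x = e := WithOne.coe_injective (by simpa using hv)
      rwa [this]
    | coe v =>
      have : x * v = e := WithOne.coe_injective (by simpa [c] using hv)
      rw [← this, aux_map] at hx
      exact hx.1

/-- For an `E`-separated `E`-semigroup `X` with `⇕E(X) = ⋃_{e∈E(X)} ⇕e`: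
(1) `⇕E(X)` is a subsemigroup `S` of `X`, every `x ∈ S` has a unique idempotent in its
`𝟐`-class, and the map `π⇕ : S → E(X)` assigning this idempotent is a homomorphic
retraction of `S` onto `E(X)`; (2) `ℏ⇕ : S → H(X)`, `x ↦ x·π⇕(x)`, is a homomorphic
retraction of `S` onto the Clifford part `H(X)`; (3) `H(X)` is a subsemigroup of `X`. -/
theorem stmt_18 {X : Type u} [Semigroup X] (hsep : ESeparated X)
    (hE : ∀ e f : X, e * e = e → f * f = f → (e * f) * (e * f) = e * f) :
    ∃ S : Subsemigroup X, (S : Set X) = {x | ∃ e : X, e * e = e ∧ x ∈ twoClass e} ∧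
      (∀ x : S, ∃! e : X, e * e = e ∧ e ∈ twoClass (x : X)) ∧
      ∃ p : S →ₙ* X,
        (∀ x : S, p x * p x = p x ∧ p x ∈ twoClass (x : X)) ∧
        (∀ x : S, (x : X) * (x : X) = (x : X) → p x = (x : X)) ∧
        (∀ x : S, (x : X) * p x ∈ CliffordPart X) ∧
        (∀ x y : S, ((x : X) * p x) * ((y : X) * p y) = ((x * y : S) : X) * p (x * y)) ∧
        (∀ x : S, (x : X) ∈ CliffordPart X → (x : X) * p x = (x : X)) ∧
        (∀ a b : X, a ∈ CliffordPart X → b ∈ CliffordPart X →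
          a * b ∈ CliffordPart X) := by
  have hS : ∀ {x y e f : X}, x ∈ twoClass e → y ∈ twoClass f → x * y ∈ twoClass (e * f) := by
    intro x y e f hx hy
    rw [aux_two] at *
    intro χ
    rw [aux_map, aux_map, hx, hy]
  let S : Subsemigroup X :=
    { carrier := {x | ∃ e : X, e * e = e ∧ x ∈ twoClass e}
      mul_mem' := by
        rintro x y ⟨e, he, hx⟩ ⟨f, hf, hy⟩
        exact ⟨e * f, hE e f he hf, hS hx hy⟩ }
  have hex : ∀ x : S, ∃ e : X, e * e = e ∧ ∀ χ : X →ₙ* Bool, χ (x : X) = true ↔ χ e = true := by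
    rintro ⟨x, e, he, hx⟩
    exact ⟨e, he, aux_two.1 hx⟩
  choose q hq hqx using hex
  have hu : ∀ (x : S) (e : X), e * e = e →
      (∀ χ : X →ₙ* Bool, χ (x : X) = true ↔ χ e = true) → q x = e := by
    intro x e he h
    exact aux_uniq hsep (hq x) he fun χ => (hqx x χ).symm.trans (h χ)
  have hmul : ∀ x y : S, q (x * y) = q x * q y := by
    intro x y
    refine hu _ _ (hE _ _ (hq x) (hq y)) fun χ => ?_
    rw [MulMemClass.coe_mul, aux_map, aux_map, hqx x, hqx y]
  have hmem : ∀ x : X, x ∈ CliffordPart X → x ∈ S := by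
    rintro x ⟨e, he, hx⟩
    exact ⟨e, he, aux_two.2 (aux_ofH he hx).2⟩
  have hcl : ∀ x : S, (x : X) * q x ∈ CliffordPart X := fun x =>
    ⟨q x, hq x, aux_memH hsep (hq x) fun χ => (hqx x χ).2⟩
  have hret : ∀ x : S, (x : X) ∈ CliffordPart X → (x : X) * q x = x := by
    rintro x ⟨e, he, hx⟩
    obtain ⟨h1, h2⟩ := aux_ofH he hx
    rw [hu x e he h2, h1]
  have hhom : ∀ x y : S, ((x : X) * q x) * ((y : X) * q y) = ((x * y : S) : X) * q (x * y) := by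
    intro x y
    have h1 := (aux_up hsep (hq y) fun χ => (hqx y χ).2).1
    have h2 := (aux_up hsep (hE _ _ (hq x) (hq y)) (x := (y : X)) fun χ h =>
      (hqx y χ).2 ((aux_map χ _ _).1 h).2).1
    rw [hmul, MulMemClass.coe_mul, h1, mul_assoc (x : X) y, h2]
    simp only [mul_assoc]
  refine ⟨S, rfl, ?_, ⟨q, hmul⟩, ?_, ?_, hcl, hhom, hret, ?_⟩
  · intro x
    refine ⟨q x, ⟨hq x, aux_two.2 fun χ => (hqx x χ).symm⟩, ?_⟩
    rintro e ⟨he, h⟩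
    exact (hu x e he fun χ => (aux_two.1 h χ).symm).symm
  · exact fun x => ⟨hq x, aux_two.2 fun χ => (hqx x χ).symm⟩
  · exact fun x hx => hu x x hx fun χ => Iff.rfl
  · intro a b ha hb
    have h := hhom ⟨a, hmem a ha⟩ ⟨b, hmem b hb⟩
    rw [hret _ ha, hret _ hb] at h
    change a * b = _ at h
    rw [h]
    exact hcl _
end
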